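/- arXiv:1804.10786 — 3 statements merged into one kernel-verified Lean document; each statement's English description precedes it below -/
import Mathlib

section
/- Let X be an infinite set equipped with the Fort topology with particular point b ∈ X, and let C, D be nonempty subsets of X with b ∉ C ∪ D. If card(C) = card(D) = card(X), then there exist a nonzero cardinal λ and a C-(X,D,λ) Top-design of type 1 if and only if D = X \ {b}. -/
open Cardinal Set Filter

universe u v

/-- The topology on `α` is the Fort topology with particular point `b`. -/
def IsFort {α : Type*} [TopologicalSpace α] (b : α) : Prop :=
  ∀ U : Set α, IsOpen U ↔ b ∉ U ∨ (Uᶜ : Set α).Finite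

/-- `S ≈ T` : the subspaces `S` and `T` are homeomorphic. -/
def Homeo {α : Type*} [TopologicalSpace α] (S T : Set α) : Prop :=
  Nonempty (S ≃ₜ T)

/-- `C` can be embedded into `D`: there is `E ⊆ D` with `E ≈ C`. -/
def CanEmbed {α : Type*} [TopologicalSpace α] (C D : Set α) : Prop :=
  ∃ E : Set α, E ⊆ D ∧ Homeo E C

/-- `A` is a `C-(X,D,lam)` Top-design of type 1. -/
def IsTopDesign1 {X : Type u} [TopologicalSpace X] (C D : Set X)
    (lam : Cardinal.{u}) (A : Set (Set X)) : Prop :=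
  (∀ B ∈ A, Homeo B D ∧ Homeo (Bᶜ : Set X) (Dᶜ : Set X)) ∧
  ∀ E : Set X, Homeo E C → #↥{B ∈ A | E ⊆ B} = lam

/-- `A` is a `C-(X,D,lam)` Top-design of type 2. -/
def IsTopDesign2 {X : Type u} [TopologicalSpace X] (C D : Set X)
    (lam : Cardinal.{u}) (A : Set (Set X)) : Prop :=
  (∀ B ∈ A, Homeo B D) ∧
  ∀ E : Set X, Homeo E C → #↥{B ∈ A | E ⊆ B} = lam

/-- `A` is a `C-(X,D,lam)` Top-design of type 3. -/
def IsTopDesign3 {X : Type u} [TopologicalSpace X] (C D : Set X)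
    (lam : Cardinal.{u}) (A : Set (Set X)) : Prop :=
  (∀ B ∈ A, Homeo B D ∧ Homeo (Bᶜ : Set X) (Dᶜ : Set X)) ∧
  ∀ E : Set X, Homeo E C → Homeo (Eᶜ : Set X) (Cᶜ : Set X) →
    #↥{B ∈ A | E ⊆ B} = lam

/-- `A` is a `C-(X,D,lam)` Top-design of type 4. -/
def IsTopDesign4 {X : Type u} [TopologicalSpace X] (C D : Set X)
    (lam : Cardinal.{u}) (A : Set (Set X)) : Prop :=
  (∀ B ∈ A, Homeo B D) ∧
  ∀ E : Set X, Homeo E C → Homeo (Eᶜ : Set X) (Cᶜ : Set X) →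
    #↥{B ∈ A | E ⊆ B} = lam

/-- A subspace missing the particular point is discrete. -/
theorem IsFort.discreteTopology {X : Type*} [TopologicalSpace X] {b : X} (hX : IsFort b)
    {S : Set X} (hS : b ∉ S) : DiscreteTopology S := by
  refine discreteTopology_iff_isOpen_singleton.2 fun x => ?_
  have hx : IsOpen ({x.1} : Set X) :=
    (hX _).2 (Or.inl fun h => hS ((mem_singleton_iff.1 h) ▸ x.2))
  convert hx.preimage continuous_subtype_val
  ext y
  simp [Subtype.ext_iff]

/-- An infinite discrete subspace misses the particular point. -/
theorem IsFort.notMem_of_discreteTopology {X : Type*} [TopologicalSpace X] {b : X}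
    (hX : IsFort b) {S : Set X} (hS : S.Infinite) [DiscreteTopology S] : b ∉ S := by
  intro hb
  obtain ⟨U, hU, hUS⟩ := isOpen_induced_iff.1 (isOpen_discrete ({⟨b, hb⟩} : Set S))
  have hmem : ∀ y (hy : y ∈ S), y ∈ U ↔ y = b := fun y hy => by
    simpa using Set.ext_iff.1 hUS ⟨y, hy⟩
  have hfin : (Uᶜ : Set X).Finite := ((hX U).1 hU).resolve_left fun h => h ((hmem b hb).2 rfl)
  refine hS ((hfin.insert b).subset fun y hy => ?_)
  by_cases hyb : y = b
  · exact Or.inl hyb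
  · exact Or.inr fun hyU => hyb ((hmem y hy).1 hyU)

/-- A set homeomorphic to an infinite set missing the particular point misses it too. -/
theorem IsFort.notMem_of_homeo {X : Type*} [TopologicalSpace X] {b : X} (hX : IsFort b)
    {S T : Set X} (h : Homeo S T) (hT : T.Infinite) (hb : b ∉ T) : b ∉ S := by
  obtain ⟨e⟩ := h
  have := hX.discreteTopology hb
  have : DiscreteTopology S := e.symm.discreteTopology
  have := hT.to_subtype
  exact hX.notMem_of_discreteTopology (infinite_coe_iff.1 (e.toEquiv.infinite_iff.2 this))

/-- Equinumerous sets missing the particular point are homeomorphic. -/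
theorem IsFort.homeo_of_mk_eq {X : Type*} [TopologicalSpace X] {b : X} (hX : IsFort b)
    {S T : Set X} (hS : b ∉ S) (hT : b ∉ T) (h : #S = #T) : Homeo S T := by
  have := hX.discreteTopology hS
  have := hX.discreteTopology hT
  obtain ⟨e⟩ := Cardinal.eq.1 h
  exact ⟨e.toHomeomorphOfDiscrete⟩

theorem exists_type1_iff_compl_singleton {X : Type u} [TopologicalSpace X] [Infinite X]
    (b : X) (hX : IsFort b) (C D : Set X) (hC : C.Nonempty) (hD : D.Nonempty)
    (hb : b ∉ C ∪ D) (hCX : #↥C = #X) (hDX : #↥D = #X) :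
    (∃ lam : Cardinal.{u}, lam ≠ 0 ∧ ∃ A : Set (Set X), IsTopDesign1 C D lam A) ↔
      D = ({b}ᶜ : Set X) := by
  have hbC : b ∉ C := fun h => hb (Or.inl h)
  have hbD : b ∉ D := fun h => hb (Or.inr h)
  have infinite_of_mk_eq : ∀ {S : Set X}, #S = #X → S.Infinite := fun {S} h =>
    infinite_coe_iff.1 (Cardinal.infinite_iff.2 (h ▸ aleph0_le_mk X))
  constructor
  · rintro ⟨lam, hlam, A, hA, hcount⟩
    have hbb : b ∉ ({b}ᶜ : Set X) := fun h => h rfl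
    have hcard : #({b}ᶜ : Set X) = #X :=
      mk_compl_of_infinite _ (by simpa using one_lt_aleph0.trans_le (aleph0_le_mk X))
    have hne := hcount _ (hX.homeo_of_mk_eq hbb hbC (hcard.trans hCX.symm)) ▸ hlam
    obtain ⟨B, hBA, hB⟩ := Cardinal.mk_ne_zero_iff.1 hne
    obtain ⟨hBD, ⟨e⟩⟩ := hA B hBA
    have hbB : b ∉ B := hX.notMem_of_homeo hBD (infinite_of_mk_eq hDX) hbD
    have hBc : Bᶜ ⊆ {b} := compl_subset_comm.1 hB
    have hsub : Subsingleton ↥(Bᶜ) := (subsingleton_singleton.anti hBc).coe_sort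
    have hDc : (Dᶜ : Set X).Subsingleton :=
      subsingleton_coe _ |>.1 e.symm.toEquiv.subsingleton
    rw [← compl_compl D, hDc.eq_singleton_of_mem hbD]
  · rintro rfl
    refine ⟨1, one_ne_zero, {{b}ᶜ}, ?_, fun E hE => ?_⟩
    · rintro B rfl
      exact ⟨⟨Homeomorph.refl _⟩, ⟨Homeomorph.refl _⟩⟩
    · have hbE : b ∉ E := hX.notMem_of_homeo hE (infinite_of_mk_eq hCX) hbC
      have hEq : {B ∈ ({{b}ᶜ} : Set (Set X)) | E ⊆ B} = {{b}ᶜ} :=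
        sep_eq_self_iff_mem_true.2 fun B hB => by
          rw [mem_singleton_iff.1 hB]
          exact subset_compl_singleton_iff.2 hbE
      rw [hEq, mk_singleton]
end

section
/- Let X be an infinite set equipped with the Fort topology with particular point b ∈ X, and let C, D be nonempty subsets of X. If b ∈ C \ D, then for no nonzero cardinal λ does there exist a C-(X,D,λ) Top-design of type 1. -/
open Cardinal Set Filter

universe u v

/-- A subspace of a Fort space avoiding the particular point is discrete. -/
theorem IsFort.discreteTopology_of_notMem {α : Type*} [TopologicalSpace α] {b : α}
    (hX : IsFort b) {T : Set α} (hT : b ∉ T) : DiscreteTopology T := by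
  refine discreteTopology_iff_forall_isOpen.2 fun s => ?_
  refine ⟨Subtype.val '' s, (hX _).2 (Or.inl ?_), preimage_image_eq s Subtype.val_injective⟩
  rintro ⟨x, -, rfl⟩
  exact hT x.2

/-- A discrete subspace of a Fort space containing the particular point is finite. -/
theorem IsFort.finite_of_discreteTopology {α : Type*} [TopologicalSpace α] {b : α}
    (hX : IsFort b) {S : Set α} (hS : b ∈ S) [DiscreteTopology S] : S.Finite := by
  obtain ⟨U, hU, hUS⟩ := isOpen_induced_iff.1 (isOpen_discrete ({⟨b, hS⟩} : Set S))
  have hbU : b ∈ U := by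
    have : (⟨b, hS⟩ : S) ∈ Subtype.val ⁻¹' U := hUS ▸ mem_singleton _
    exact this
  have hfin : (Uᶜ : Set α).Finite := ((hX U).1 hU).resolve_left fun h => h hbU
  refine (hfin.insert b).subset fun x hx => ?_
  by_cases hxU : x ∈ U
  · have : (⟨x, hx⟩ : S) ∈ ({⟨b, hS⟩} : Set S) := hUS ▸ hxU
    exact Or.inl (congrArg Subtype.val this)
  · exact Or.inr hxU

/-- If a subspace containing the particular point is homeomorphic to one avoiding it,
then it is finite. -/
theorem IsFort.finite_of_homeo {α : Type*} [TopologicalSpace α] {b : α} (hX : IsFort b)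
    {S T : Set α} (hS : b ∈ S) (hT : b ∉ T) (h : Homeo S T) : S.Finite := by
  obtain ⟨e⟩ := h
  have := hX.discreteTopology_of_notMem hT
  have : DiscreteTopology S := e.isEmbedding.discreteTopology
  exact hX.finite_of_discreteTopology hS

theorem no_type1_of_mem_diff {X : Type u} [TopologicalSpace X] [Infinite X]
    (b : X) (hX : IsFort b) (C D : Set X) (hC : C.Nonempty) (hD : D.Nonempty)
    (hb : b ∈ C \ D) :
    ¬ ∃ lam : Cardinal.{u}, lam ≠ 0 ∧ ∃ A : Set (Set X), IsTopDesign1 C D lam A := by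
  rintro ⟨lam, hlam, A, hA, hcount⟩
  have hne : #↥{B ∈ A | C ⊆ B} ≠ 0 := hcount C ⟨Homeomorph.refl C⟩ ▸ hlam
  obtain ⟨B, hBA, hCB⟩ := Cardinal.mk_ne_zero_iff.1 hne
  obtain ⟨hBD, ⟨e⟩⟩ := hA B hBA
  have hBfin : B.Finite := hX.finite_of_homeo (hCB hb.1) hb.2 hBD
  have hDfin : D.Finite := by
    obtain ⟨f⟩ := hBD
    have := hBfin.to_subtype
    exact Finite.of_equiv B f.toEquiv
  have hDcfin : (Dᶜ : Set X).Finite :=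
    hX.finite_of_homeo hb.2 (notMem_compl_iff.2 (hCB hb.1)) ⟨e.symm⟩
  exact hDfin.infinite_compl hDcfin
end

section
/- Let X be an infinite set equipped with the Fort topology with particular point b ∈ X, and let C, D be nonempty subsets of X with b ∈ D. If card(C) = card(D) = card(X), then there exist a nonzero cardinal λ and a C-(X,D,λ) Top-design of type 1 if and only if D = X. -/
open Cardinal Set Filter

universe u v

/-- Open subsets of a subspace of a Fort space. -/
theorem IsFort.isOpen_subtype_iff {α : Type*} [TopologicalSpace α] {b : α} (hX : IsFort b)
    {S : Set α} (V : Set S) : IsOpen V ↔ (∀ s ∈ V, (s : α) ≠ b) ∨ (Vᶜ : Set S).Finite := by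
  rw [isOpen_induced_iff]
  constructor
  · rintro ⟨U, hU, rfl⟩
    rcases (hX U).1 hU with h | h
    · left
      rintro s hs rfl
      exact h hs
    · right
      rw [← preimage_compl]
      exact h.preimage Subtype.val_injective.injOn
  · rintro (h | h)
    · refine ⟨(↑) '' V, (hX _).2 (Or.inl ?_), preimage_image_eq _ Subtype.val_injective⟩
      rintro ⟨s, hs, hsb⟩
      exact h s hs hsb
    · refine ⟨((↑) '' (Vᶜ : Set S))ᶜ, (hX _).2 (Or.inr ?_), ?_⟩
      · rw [compl_compl]
        exact h.image _
      · rw [preimage_compl, preimage_image_eq _ Subtype.val_injective, compl_compl]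

theorem IsFort.continuous_equiv {α : Type*} [TopologicalSpace α] {b : α} (hX : IsFort b)
    {S T : Set α} (e : S ≃ T) (he : ∀ s : S, (s : α) = b → (e s : α) = b) : Continuous e := by
  refine ⟨fun V hV => ?_⟩
  rw [hX.isOpen_subtype_iff] at hV ⊢
  refine hV.imp (fun h s hs hsb => h _ hs (he s hsb)) fun h => ?_
  rw [← preimage_compl]
  exact h.preimage e.injective.injOn

/-- A bijection between subspaces of a Fort space respecting the particular point is a
homeomorphism. -/
theorem IsFort.homeo_of_equiv {α : Type*} [TopologicalSpace α] {b : α} (hX : IsFort b)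
    {S T : Set α} (e : S ≃ T) (he : ∀ s : S, (e s : α) = b ↔ (s : α) = b) : Homeo S T :=
  ⟨{ e with
      continuous_toFun := hX.continuous_equiv e fun s => (he s).2
      continuous_invFun := hX.continuous_equiv e.symm fun t ht =>
        (he _).1 (by rwa [e.apply_symm_apply]) }⟩

/-- A subspace homeomorphic to an infinite subspace containing the particular point also
contains it. -/
theorem IsFort.mem_of_homeo {α : Type*} [TopologicalSpace α] {b : α} (hX : IsFort b)
    {S T : Set α} (h : Homeo S T) (hT : T.Infinite) (hb : b ∈ T) : b ∈ S := by
  obtain ⟨f⟩ := h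
  by_contra hbS
  have hopen : IsOpen (f ⁻¹' {⟨b, hb⟩}) :=
    (hX.isOpen_subtype_iff _).2 (Or.inl fun s _ hs => hbS (hs ▸ s.2))
  rw [f.isOpen_preimage, hX.isOpen_subtype_iff] at hopen
  rcases hopen with h | h
  · exact h _ rfl rfl
  · have := hT.to_subtype
    exact (finite_singleton (⟨b, hb⟩ : T)).infinite_compl h

/-- A subspace of full cardinality is homeomorphic to a subspace omitting at most the
particular point. -/
theorem IsFort.exists_homeo_of_mk_eq {X : Type u} [TopologicalSpace X] [Infinite X] {b : X}
    (hX : IsFort b) {C : Set X} (hC : #↥C = #X) : ∃ E : Set X, {b}ᶜ ⊆ E ∧ Homeo E C := by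
  classical
  by_cases hb : b ∈ C
  · refine ⟨univ, subset_univ _, ?_⟩
    obtain ⟨e⟩ := Cardinal.eq.1 ((mk_univ (α := X)).trans hC.symm)
    let c : C := ⟨b, hb⟩
    refine hX.homeo_of_equiv (e.trans (Equiv.swap (e ⟨b, mem_univ b⟩) c)) fun s => ?_
    have h : (e.trans (Equiv.swap (e ⟨b, mem_univ b⟩) c)) ⟨b, mem_univ b⟩ = c := by simp
    constructor
    · intro hs
      have := (e.trans (Equiv.swap (e ⟨b, mem_univ b⟩) c)).injective
        ((Subtype.ext hs : _ = c).trans h.symm)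
      rw [this]
    · intro hs
      obtain rfl : s = ⟨b, mem_univ b⟩ := Subtype.ext hs
      exact congrArg Subtype.val h
  · refine ⟨{b}ᶜ, subset_rfl, ?_⟩
    have hlt : #↥({b} : Set X) < #X := by
      rw [mk_singleton]
      exact one_lt_aleph0.trans_le (aleph0_le_mk X)
    obtain ⟨e⟩ := Cardinal.eq.1 ((mk_compl_of_infinite _ hlt).trans hC.symm)
    exact hX.homeo_of_equiv e fun s =>
      iff_of_false (fun h => hb (h ▸ (e s).2)) s.2

theorem exists_type1_iff_eq_univ {X : Type u} [TopologicalSpace X] [Infinite X]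
    (b : X) (hX : IsFort b) (C D : Set X) (hC : C.Nonempty) (hD : D.Nonempty)
    (hb : b ∈ D) (hCX : #↥C = #X) (hDX : #↥D = #X) :
    (∃ lam : Cardinal.{u}, lam ≠ 0 ∧ ∃ A : Set (Set X), IsTopDesign1 C D lam A) ↔
      D = Set.univ := by
  constructor
  · rintro ⟨lam, hlam, A, hA, hcard⟩
    obtain ⟨E, hbE, hEC⟩ := hX.exists_homeo_of_mk_eq hCX
    rw [← hcard E hEC, mk_ne_zero_iff] at hlam
    obtain ⟨B, hBA, hEB⟩ := hlam
    obtain ⟨hBD, ⟨f⟩⟩ := hA B hBA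
    have hDinf : D.Infinite := by
      rw [← infinite_coe_iff, infinite_iff, hDX]
      exact aleph0_le_mk X
    have hbB := hX.mem_of_homeo hBD hDinf hb
    rw [eq_univ_iff_forall]
    intro x
    by_contra hx
    refine (f.symm ⟨x, hx⟩).2 ?_
    by_cases h : (f.symm ⟨x, hx⟩ : X) = b
    · rwa [h]
    · exact hEB (hbE h)
  · rintro rfl
    refine ⟨1, one_ne_zero, {Set.univ}, ?_, fun E _ => ?_⟩
    · rintro B rfl
      exact ⟨⟨Homeomorph.refl _⟩, ⟨Homeomorph.refl _⟩⟩
    · have : {B ∈ ({Set.univ} : Set (Set X)) | E ⊆ B} = {Set.univ} :=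
        sep_eq_self_iff_mem_true.2 fun B hB => hB ▸ subset_univ E
      rw [this, mk_singleton]
end
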